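/- arXiv:1803.09289 — 2 statements merged into one kernel-verified Lean document; each statement's English description precedes it below -/
import Mathlib

section
/- Let f be a minmax monotone cost function on a finite tree T_in, 𝒯 ≥ 0, T = (V,E) a working subtree with sink set S = S_out ∩ V, and let (S_out, P_out) be a partial sink configuration that is optimal relative to T. If T is RC-viable with respect to S, then there exists an optimal feasible sink configuration (S*, P*) witnessing the optimality of (S_out, P_out) relative to T such that S* contains no sink lying in any outstanding branch of T_{H(S)}. -/
open SimpleGraph Set
open scoped ENNReal

variable {V : Type*}

/-- The vertex set of the connected component of the subgraph of `G` induced on `A`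
containing the vertex `u` (empty if `u ∉ A`). -/
def reachSet (G : SimpleGraph V) (A : Set V) (u : V) : Set V :=
  {y | ∃ (hu : u ∈ A) (hy : y ∈ A), (G.induce A).Reachable ⟨u, hu⟩ ⟨y, hy⟩}

/-- `U` is a subtree: the induced subgraph on `U` is connected. -/
def IsSubtree (G : SimpleGraph V) (U : Set V) : Prop :=
  (G.induce U).Connected

/-- A minmax monotone cost function on the tree `G`:
`f {s} s = 0`; `f U s = ∞` if `U` is not a subtree or `s ∉ U`; set monotonicity;
path monotonicity; and max tree composition (the slices of `U` defined by `s` being the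
connected components of `U \ {s}`). -/
structure IsMinmaxMonotone (G : SimpleGraph V) (f : Set V → V → ℝ≥0∞) : Prop where
  singleton_eq_zero : ∀ s : V, f {s} s = 0
  eq_top_of_not_subtree : ∀ (U : Set V) (s : V), ¬ IsSubtree G U → f U s = ⊤
  eq_top_of_not_mem : ∀ (U : Set V) (s : V), s ∉ U → f U s = ⊤
  set_mono : ∀ (U₁ U₂ : Set V) (s : V), IsSubtree G U₁ → IsSubtree G U₂ →
    s ∈ U₁ → U₁ ⊆ U₂ → f U₁ s ≤ f U₂ s
  path_mono : ∀ (U : Set V) (s u : V), IsSubtree G U → s ∉ U → u ∈ U → G.Adj s u →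
    f U u ≤ f (U ∪ {s}) s
  max_comp : ∀ (U : Set V) (s : V), IsSubtree G U → s ∈ U →
    f U s = ⨆ x ∈ U \ {s}, f (reachSet G (U \ {s}) x ∪ {s}) s

/-- `s` is a leaf of the (working) tree induced on `W`. -/
def IsLeafOf (G : SimpleGraph V) (W : Set V) (s : V) : Prop :=
  s ∈ W ∧ ∃! u, u ∈ W ∧ G.Adj s u

/-- The ordered pair `(u,v)` satisfies the peaking criterion in the working tree on `W`
with sink set `S` and threshold `𝒯`. -/
def PeakingPair (G : SimpleGraph V) (f : Set V → V → ℝ≥0∞) (𝒯 : ℝ≥0∞)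
    (W S : Set V) (u v : V) : Prop :=
  u ∈ W ∧ v ∈ W ∧ G.Adj u v ∧ S ∩ reachSet G (W \ {v}) u = ∅ ∧
    f (reachSet G (W \ {v}) u) u ≤ 𝒯 ∧ 𝒯 < f (reachSet G (W \ {v}) u ∪ {v}) v

/-- `w` lies on the unique path from `a` to `b` in the tree induced on `W`. -/
def OnPath (G : SimpleGraph V) (W : Set V) (a b w : V) : Prop :=
  a ∈ W ∧ b ∈ W ∧ w ∈ W ∧ b ∉ reachSet G (W \ {w}) a

/-- Vertices of the hub tree: union of the paths from the sinks to the root `r`. -/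
def hubVerts (G : SimpleGraph V) (W S : Set V) (r : V) : Set V :=
  {w | ∃ s ∈ S, OnPath G W s r w}

/-- `r` is a valid root: a non-sink vertex of the working tree such that at least two of
the subtrees hanging off it contain sinks. -/
def GoodRoot (G : SimpleGraph V) (W S : Set V) (r : V) : Prop :=
  r ∈ W ∧ r ∉ S ∧
    ∃ η₁ η₂ : V, η₁ ≠ η₂ ∧ η₁ ∈ W ∧ η₂ ∈ W ∧ G.Adj r η₁ ∧ G.Adj r η₂ ∧
      (S ∩ reachSet G (W \ {r}) η₁).Nonempty ∧ (S ∩ reachSet G (W \ {r}) η₂).Nonempty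

/-- The working tree on `W` is RC-viable w.r.t. sinks `S` and root `r`: every outstanding
branch, together with the hub-tree node it is attached to, has cost at most `𝒯`. -/
def RCViable (G : SimpleGraph V) (f : Set V → V → ℝ≥0∞) (𝒯 : ℝ≥0∞)
    (W S : Set V) (r : V) : Prop :=
  ∀ w ∈ hubVerts G W S r, ∀ η ∈ W, G.Adj w η → η ∉ hubVerts G W S r →
    f (reachSet G (W \ {w}) η ∪ {w}) w ≤ 𝒯

/-- The set `A` is self-sufficient: it can be partitioned into subtree blocks, one for
each sink in `S ∩ A`, each block containing its sink and having cost at most `𝒯`. -/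
def SelfSufficient (G : SimpleGraph V) (f : Set V → V → ℝ≥0∞) (𝒯 : ℝ≥0∞)
    (S A : Set V) : Prop :=
  ∃ P : V → Set V,
    (⋃ s ∈ S ∩ A, P s) = A ∧
    (∀ s ∈ S ∩ A, IsSubtree G (P s) ∧ s ∈ P s ∧ f (P s) s ≤ 𝒯) ∧
    (S ∩ A).Pairwise fun s t => Disjoint (P s) (P t)

/-- The vertices of the path `Π(a,b)` in the tree induced on `W`. -/
def pathSet (G : SimpleGraph V) (W : Set V) (a b : V) : Set V :=
  {w | OnPath G W a b w}

/-- All vertices of outstanding branches attached to `w` (given hub-tree vertices `Hub`). -/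
def branchesAt (G : SimpleGraph V) (W Hub : Set V) (w : V) : Set V :=
  ⋃ η ∈ {η : V | η ∈ W ∧ G.Adj w η ∧ η ∉ Hub}, reachSet G (W \ {w}) η

/-- The bulk path `BP(a,b)`: the path `Π(a,b)` together with all outstanding branches
attached to its vertices. -/
def bulkPath (G : SimpleGraph V) (W S : Set V) (r a b : V) : Set V :=
  pathSet G W a b ∪ ⋃ w ∈ pathSet G W a b, branchesAt G W (hubVerts G W S r) w

/-- `v` is the parent of `u` in the hub tree rooted at `r`. -/
def HubParent (G : SimpleGraph V) (W S : Set V) (r u v : V) : Prop :=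
  u ∈ hubVerts G W S r ∧ v ∈ hubVerts G W S r ∧ G.Adj u v ∧ OnPath G W u r v

/-- The ordered pair `(u,v)` satisfies the reaching criterion: `v` is the hub-tree parent
of `u`, `T₋ᵥ(u)` is self-sufficient, and `BP(v,v) ∪ V₋ᵥ(u)` is not self-sufficient. -/
def ReachingPair (G : SimpleGraph V) (f : Set V → V → ℝ≥0∞) (𝒯 : ℝ≥0∞)
    (W S : Set V) (r u v : V) : Prop :=
  HubParent G W S r u v ∧
  SelfSufficient G f 𝒯 S (reachSet G (W \ {v}) u) ∧
  ¬ SelfSufficient G f 𝒯 S (bulkPath G W S r v v ∪ reachSet G (W \ {v}) u)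

/-- The vertex set `V(v)` of the subtree of the working tree (rooted at `r`) rooted at `v`:
all vertices whose path to the root passes through `v`. -/
def rootedBelow (G : SimpleGraph V) (W : Set V) (r v : V) : Set V :=
  {x | OnPath G W x r v}

/-- The rooted subtree `T(v)` is RC-viable: every outstanding branch attached to a
hub-tree node lying in `T(v)` has, together with its attachment node, cost at most `𝒯`. -/
def RCViableBelow (G : SimpleGraph V) (f : Set V → V → ℝ≥0∞) (𝒯 : ℝ≥0∞)
    (W S : Set V) (r v : V) : Prop :=
  ∀ w ∈ hubVerts G W S r ∩ rootedBelow G W r v, ∀ η ∈ W, G.Adj w η →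
    η ∉ hubVerts G W S r → f (reachSet G (W \ {w}) η ∪ {w}) w ≤ 𝒯

/-- The subtree with vertex set `A` (of the working tree rooted at `r`) is recursively
self-sufficient: for every hub-tree node `w` in `A`, the part of `A` lying below `w`
is self-sufficient. -/
def RecursivelySelfSufficientOn (G : SimpleGraph V) (f : Set V → V → ℝ≥0∞) (𝒯 : ℝ≥0∞)
    (W S : Set V) (r : V) (A : Set V) : Prop :=
  ∀ w ∈ hubVerts G W S r ∩ A, SelfSufficient G f 𝒯 S (rootedBelow G W r w ∩ A)

/-- A feasible sink configuration: a partition of all of `V_in` into subtree blocks,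
one per sink, each block containing exactly its own sink and having cost at most `𝒯`. -/
def IsFeasibleConfig (G : SimpleGraph V) (f : Set V → V → ℝ≥0∞) (𝒯 : ℝ≥0∞)
    (St : Set V) (P : V → Set V) : Prop :=
  (⋃ s ∈ St, P s) = Set.univ ∧
  St.Pairwise (fun s t => Disjoint (P s) (P t)) ∧
  ∀ s ∈ St, IsSubtree G (P s) ∧ St ∩ P s = {s} ∧ f (P s) s ≤ 𝒯

/-- An optimal feasible sink configuration: one with the minimum number of sinks. -/
def IsOptimalConfig (G : SimpleGraph V) (f : Set V → V → ℝ≥0∞) (𝒯 : ℝ≥0∞)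
    (St : Set V) (P : V → Set V) : Prop :=
  IsFeasibleConfig G f 𝒯 St P ∧
  ∀ (St' : Set V) (P' : V → Set V), IsFeasibleConfig G f 𝒯 St' P' → St.ncard ≤ St'.ncard

/-- A partial sink configuration relative to the working tree on `W`: pairwise disjoint
subtree blocks of cost at most `𝒯`, one per sink of `Sout`, covering `V_in \ (W \ Sout)`. -/
def IsPartialConfig (G : SimpleGraph V) (f : Set V → V → ℝ≥0∞) (𝒯 : ℝ≥0∞)
    (W : Set V) (Sout : Set V) (P : V → Set V) : Prop :=
  Sout.Pairwise (fun s t => Disjoint (P s) (P t)) ∧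
  (∀ s ∈ Sout, IsSubtree G (P s) ∧ s ∈ P s ∧ f (P s) s ≤ 𝒯) ∧
  (⋃ s ∈ Sout, P s) = Set.univ \ (W \ Sout)

/-- `(St, Pt)` is an optimal feasible sink configuration witnessing the optimality of the
partial configuration `(Sout, P)` relative to the working tree on `W` (conditions (C1)-(C3)). -/
def WitnessesOptimality (G : SimpleGraph V) (f : Set V → V → ℝ≥0∞) (𝒯 : ℝ≥0∞)
    (W : Set V) (Sout : Set V) (P : V → Set V) (St : Set V) (Pt : V → Set V) : Prop :=
  IsOptimalConfig G f 𝒯 St Pt ∧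
  Sout ⊆ St ∧
  St \ W = Sout \ W ∧
  (∀ s ∈ Sout ∩ W, IsLeafOf G W s) ∧
  (∀ s ∈ St, s ∉ W → Pt s = P s ∧ Pt s ∩ W = ∅) ∧
  (∀ s ∈ Sout ∩ W, P s ⊆ Pt s ∧ Pt s \ P s ⊆ W) ∧
  (∀ s ∈ St, s ∉ Sout → Pt s ⊆ W)

/-- The partial sink configuration `(Sout, P)` is optimal relative to the working tree on `W`. -/
def OptimalRelative (G : SimpleGraph V) (f : Set V → V → ℝ≥0∞) (𝒯 : ℝ≥0∞)
    (W : Set V) (Sout : Set V) (P : V → Set V) : Prop :=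
  ∃ (St : Set V) (Pt : V → Set V), WitnessesOptimality G f 𝒯 W Sout P St Pt

theorem reachSet_subset (G : SimpleGraph V) (A : Set V) (u : V) : reachSet G A u ⊆ A :=
  fun _ ⟨_, hy, _⟩ => hy

theorem mem_reachSet_of_walk {G : SimpleGraph V} {A : Set V} {u y : V} (p : G.Walk u y)
    (hp : ∀ x ∈ p.support, x ∈ A) : y ∈ reachSet G A u :=
  ⟨hp _ p.start_mem_support, hp _ p.end_mem_support, ⟨p.induce A hp⟩⟩

theorem exists_path_of_mem_reachSet {G : SimpleGraph V} {A : Set V} {u y : V}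
    (h : y ∈ reachSet G A u) : ∃ p : G.Walk u y, p.IsPath ∧ ∀ x ∈ p.support, x ∈ A := by
  classical
  obtain ⟨hu, hy, ⟨q⟩⟩ := h
  refine ⟨(q.map (Embedding.induce A).toHom).bypass, Walk.bypass_isPath _, fun x hx => ?_⟩
  have hx' : x ∈ (q.map (Embedding.induce A).toHom).support :=
    Walk.support_bypass_subset_support _ hx
  rw [Walk.support_map] at hx'
  obtain ⟨z, -, rfl⟩ := List.mem_map.1 hx'
  exact z.2

theorem mem_reachSet_self {G : SimpleGraph V} {A : Set V} {u : V} (h : u ∈ A) :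
    u ∈ reachSet G A u := ⟨h, h, .rfl⟩

theorem reachSet_symm {G : SimpleGraph V} {A : Set V} {u y : V} :
    y ∈ reachSet G A u → u ∈ reachSet G A y :=
  fun ⟨hu, hy, h⟩ => ⟨hy, hu, h.symm⟩

theorem reachSet_trans {G : SimpleGraph V} {A : Set V} {u y z : V} :
    y ∈ reachSet G A u → z ∈ reachSet G A y → z ∈ reachSet G A u :=
  fun ⟨hu, _, h⟩ ⟨_, hz, h'⟩ => ⟨hu, hz, h.trans h'⟩

theorem reachSet_mono {G : SimpleGraph V} {A B : Set V} (h : A ⊆ B) (u : V) :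
    reachSet G A u ⊆ reachSet G B u := fun _ hy =>
  let ⟨p, _, hp⟩ := exists_path_of_mem_reachSet hy
  mem_reachSet_of_walk p fun x hx => h (hp x hx)

theorem IsSubtree.mem_reachSet {G : SimpleGraph V} {A : Set V} (hA : IsSubtree G A) {u y : V}
    (hu : u ∈ A) (hy : y ∈ A) : y ∈ reachSet G A u :=
  ⟨hu, hy, hA.preconnected _ _⟩

theorem isSubtree_of_forall_reachSet {G : SimpleGraph V} {A : Set V} {w : V} (hw : w ∈ A)
    (h : ∀ y ∈ A, w ∈ reachSet G A y) : IsSubtree G A := by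
  have : Nonempty A := ⟨⟨w, hw⟩⟩
  refine Connected.mk fun x y => ?_
  obtain ⟨_, _, hx⟩ := h x x.2
  obtain ⟨_, _, hy⟩ := h y y.2
  exact hx.trans hy.symm

theorem isSubtree_reachSet {G : SimpleGraph V} {A : Set V} {u : V} (hu : u ∈ A) :
    IsSubtree G (reachSet G A u) := by
  classical
  refine isSubtree_of_forall_reachSet (mem_reachSet_self hu) fun y hy => reachSet_symm ?_
  obtain ⟨p, _, hp⟩ := exists_path_of_mem_reachSet hy
  exact mem_reachSet_of_walk p fun x hx =>
    mem_reachSet_of_walk (p.takeUntil x hx) fun z hz =>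
      hp z (p.support_takeUntil_subset_support hx hz)

/-- A vertex set containing `w` and closed under reachability in `A \ {w}` is a subtree. -/
theorem IsSubtree.of_reachSet_closed {G : SimpleGraph V} {A K : Set V} (hA : IsSubtree G A)
    {w : V} (hKA : K ⊆ A) (hw : w ∈ K) (hK : ∀ y ∈ K, reachSet G (A \ {w}) y ⊆ K) :
    IsSubtree G K := by
  classical
  refine isSubtree_of_forall_reachSet hw fun y hy => ?_
  obtain ⟨p, hp, hpA⟩ := exists_path_of_mem_reachSet (hA.mem_reachSet (hKA hy) (hKA hw))
  refine mem_reachSet_of_walk p fun x hx => ?_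
  by_cases hxw : x = w
  · exact hxw ▸ hw
  · refine hK y hy (mem_reachSet_of_walk (p.takeUntil x hx) fun z hz => ?_)
    refine ⟨hpA z (p.support_takeUntil_subset_support hx hz), ?_⟩
    rintro rfl
    exact Walk.endpoint_notMem_support_takeUntil hp hx (Ne.symm hxw) hz

theorem IsSubtree.reachSet_union_singleton {G : SimpleGraph V} {A : Set V} (hA : IsSubtree G A)
    {w : V} (hw : w ∈ A) (x : V) : IsSubtree G (reachSet G (A \ {w}) x ∪ {w}) := by
  refine hA.of_reachSet_closed (w := w) ?_ (.inr rfl) ?_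
  · rintro y (hy | rfl)
    · exact (reachSet_subset _ _ _ hy).1
    · exact hw
  · rintro y (hy | rfl) z hz
    · exact .inl (reachSet_trans hy hz)
    · exact absurd rfl hz.1.2

theorem IsSubtree.diff_reachSet {G : SimpleGraph V} {A : Set V} (hA : IsSubtree G A)
    {w : V} (hw : w ∈ A) (t : V) : IsSubtree G (A \ reachSet G (A \ {w}) t) := by
  refine hA.of_reachSet_closed (w := w) sdiff_subset
    ⟨hw, fun h => (reachSet_subset _ _ _ h).2 rfl⟩ fun y hy z hz => ?_
  exact ⟨(reachSet_subset _ _ _ hz).1, fun h => hy.2 (reachSet_trans h (reachSet_symm hz))⟩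

theorem SimpleGraph.IsTree.walk_eq {G : SimpleGraph V} (hG : G.IsTree) {u v : V} {p q : G.Walk u v}
    (hp : p.IsPath) (hq : q.IsPath) : p = q :=
  (hG.existsUnique_path u v).unique hp hq

/-- Moving the sink along a path leaving a subtree does not decrease the cost. -/
theorem IsMinmaxMonotone.le_union_support {G : SimpleGraph V} {f : Set V → V → ℝ≥0∞}
    (hf : IsMinmaxMonotone G f) {D : Set V} {t w : V} (hD : IsSubtree G D) (hw : w ∈ D)
    (p : G.Walk t w) (hp : p.IsPath) (hpD : ∀ x ∈ p.support, x ∈ D → x = w) :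
    IsSubtree G (D ∪ {x | x ∈ p.support}) ∧ f D w ≤ f (D ∪ {x | x ∈ p.support}) t := by
  induction p with
  | nil =>
    rw [union_eq_left.2 fun x hx => by simpa using (by simpa using hx : x = _) ▸ hw]
    exact ⟨hD, le_rfl⟩
  | @cons t u w h p ih =>
    rw [Walk.cons_isPath_iff] at hp
    obtain ⟨hsub, hle⟩ := ih hw hp.1 fun x hx => hpD x (by simp [hx])
    have htD : t ∉ D := fun htD =>
      hp.2 ((hpD t (by simp) htD).symm ▸ p.end_mem_support)
    have hset : D ∪ {x | x ∈ (Walk.cons h p).support} = (D ∪ {x | x ∈ p.support}) ∪ {t} := by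
      ext x; simp only [Walk.support_cons, List.mem_cons, mem_union, mem_ofPred_eq,
        mem_singleton_iff]; tauto
    rw [hset]
    have hu : u ∈ D ∪ {x | x ∈ p.support} := .inr p.start_mem_support
    refine ⟨isSubtree_of_forall_reachSet (w := u) (.inl hu) ?_,
      hle.trans (hf.path_mono _ _ _ hsub (by rintro (h | h); exacts [htD h, hp.2 h]) hu h)⟩
    rintro y (hy | rfl)
    · exact reachSet_mono subset_union_left _ (hsub.mem_reachSet hy hu)
    · refine mem_reachSet_of_walk h.toWalk fun x hx => ?_
      have : x = y ∨ x = u := by simpa using hx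
      rcases this with rfl | rfl
      exacts [.inr rfl, .inl hu]

/-- The part of `A` that reaches the sink `t` only through `w` costs at most as much at `w` as
`A` costs at `t`. -/
theorem IsMinmaxMonotone.diff_reachSet_le {G : SimpleGraph V} {f : Set V → V → ℝ≥0∞}
    (hf : IsMinmaxMonotone G f) {A : Set V} (hA : IsSubtree G A) {t w : V} (ht : t ∈ A)
    (hw : w ∈ A) : f (A \ reachSet G (A \ {w}) t) w ≤ f A t := by
  classical
  obtain ⟨p, hp, hpA⟩ := exists_path_of_mem_reachSet (hA.mem_reachSet ht hw)
  obtain ⟨hsub, hle⟩ := hf.le_union_support (hA.diff_reachSet hw t)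
    ⟨hw, fun h => (reachSet_subset _ _ _ h).2 rfl⟩ p hp fun x hx hxD => by
      by_contra hxw
      refine hxD.2 (mem_reachSet_of_walk (p.takeUntil x hx) fun z hz => ?_)
      refine ⟨hpA z (p.support_takeUntil_subset_support hx hz), ?_⟩
      rintro rfl
      exact Walk.endpoint_notMem_support_takeUntil hp hx (Ne.symm hxw) hz
  exact hle.trans (hf.set_mono _ _ _ hsub hA (.inr p.start_mem_support)
    (union_subset sdiff_subset hpA))

/-- In a tree, reachability inside `A` is inherited by a subtree `W` containing both ends. -/
theorem SimpleGraph.IsTree.mem_reachSet_inter {G : SimpleGraph V} (hG : G.IsTree) {W A : Set V}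
    (hW : IsSubtree G W) {u y : V} (hu : u ∈ W) (hy : y ∈ W) (h : y ∈ reachSet G A u) :
    y ∈ reachSet G (W ∩ A) u := by
  obtain ⟨p, hp, hpA⟩ := exists_path_of_mem_reachSet h
  obtain ⟨q, hq, hqW⟩ := exists_path_of_mem_reachSet (hW.mem_reachSet hu hy)
  obtain rfl := hG.walk_eq hp hq
  exact mem_reachSet_of_walk p fun x hx => ⟨hqW x hx, hpA x hx⟩

theorem SimpleGraph.IsTree.mem_reachSet_diff {G : SimpleGraph V} (hG : G.IsTree) {W A : Set V}
    (hW : IsSubtree G W) {u y w : V} (hu : u ∈ W) (hy : y ∈ W) (h : y ∈ reachSet G A u)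
    (hw : w ∉ A) : y ∈ reachSet G (W \ {w}) u :=
  have hsub : W ∩ A ⊆ W \ {w} := fun _ hx => ⟨hx.1, by rintro rfl; exact hw hx.2⟩
  reachSet_mono hsub _
    (hG.mem_reachSet_inter hW hu hy h)

theorem mem_hubVerts_of_mem_sinks {G : SimpleGraph V} {W S : Set V} {r s : V} (hr : r ∈ W)
    (hsW : s ∈ W) (hs : s ∈ S) : s ∈ hubVerts G W S r :=
  ⟨s, hs, hsW, hr, hsW, fun h => h.choose.2 rfl⟩

theorem hubVerts_subset (G : SimpleGraph V) (W S : Set V) (r : V) : hubVerts G W S r ⊆ W :=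
  fun _ ⟨_, _, h⟩ => h.2.2.1

theorem root_mem_reachSet_hubVerts {G : SimpleGraph V} (hG : G.IsTree) {W S : Set V} {r h : V}
    (hW : IsSubtree G W) (hh : h ∈ hubVerts G W S r) : r ∈ reachSet G (hubVerts G W S r) h := by
  classical
  obtain ⟨s, hs, hsW, hrW, hhW, hsep⟩ := hh
  obtain ⟨p, hp, hpW⟩ := exists_path_of_mem_reachSet (hW.mem_reachSet hsW hrW)
  have hhp : h ∈ p.support := by
    by_contra hhp
    exact hsep (mem_reachSet_of_walk p fun x hx => ⟨hpW x hx, by rintro rfl; exact hhp hx⟩)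
  refine mem_reachSet_of_walk (p.dropUntil h hhp) fun x hx => ?_
  have hxp := p.support_dropUntil_subset_support hhp hx
  refine ⟨s, hs, hsW, hrW, hpW x hxp, fun hr => ?_⟩
  obtain ⟨q, hq, hqW⟩ := exists_path_of_mem_reachSet hr
  obtain rfl := hG.walk_eq hp hq
  exact (hqW x hxp).2 rfl

/-- Outstanding branches do not meet the hub tree. -/
theorem disjoint_branch_hubVerts {G : SimpleGraph V} (hG : G.IsTree) {W S : Set V} {r w η : V}
    (hW : IsSubtree G W) (hw : w ∈ hubVerts G W S r) (hadj : G.Adj w η)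
    (hη : η ∉ hubVerts G W S r) :
    Disjoint (reachSet G (W \ {w}) η) (hubVerts G W S r) := by
  refine disjoint_left.2 fun y hyB hyH => hη ?_
  obtain ⟨p, hp, hpW⟩ := exists_path_of_mem_reachSet hyB
  obtain ⟨q, hq, hqH⟩ := exists_path_of_mem_reachSet
    (reachSet_trans (root_mem_reachSet_hubVerts hG hW hw)
      (reachSet_symm (root_mem_reachSet_hubVerts hG hW hyH)))
  have hp' : (Walk.cons hadj p).IsPath :=
    (Walk.cons_isPath_iff _ _).2 ⟨hp, fun h => (hpW w h).2 rfl⟩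
  obtain rfl := hG.walk_eq hp' hq
  exact hqH η (by simp)

/-- No outstanding branch is attached to a sink that is a leaf of the working tree. -/
theorem notMem_of_adj_outstanding {G : SimpleGraph V} (hG : G.IsTree) {W S : Set V} {r w η : V}
    (hW : IsSubtree G W) (hleaf : ∀ s ∈ S, IsLeafOf G W s) (hr : r ∉ S)
    (hw : w ∈ hubVerts G W S r) (hηW : η ∈ W) (hadj : G.Adj w η) (hη : η ∉ hubVerts G W S r) :
    w ∉ S := by
  intro hwS
  obtain ⟨p, hp, hpH⟩ := exists_path_of_mem_reachSet (root_mem_reachSet_hubVerts hG hW hw)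
  cases p with
  | nil => exact hr hwS
  | @cons _ z _ h p =>
    have hz : z ∈ hubVerts G W S r := hpH z (by simp)
    have := (hleaf w hwS).2.unique ⟨hηW, hadj⟩ ⟨hubVerts_subset _ _ _ _ hz, h⟩
    exact hη (this ▸ hz)

/-- All sinks of a witness lying in a cheap sink-free branch attached to `w` can be traded for
the single sink `w`. -/
theorem WitnessesOptimality.exchange [Fintype V] {G : SimpleGraph V} (hG : G.IsTree)
    {f : Set V → V → ℝ≥0∞} (hf : IsMinmaxMonotone G f) {𝒯 : ℝ≥0∞} {W : Set V}
    (hW : IsSubtree G W) {Sout : Set V} {P : V → Set V} (hpart : IsPartialConfig G f 𝒯 W Sout P)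
    {St : Set V} {Pt : V → Set V} (h : WitnessesOptimality G f 𝒯 W Sout P St Pt)
    {w η s : V} (hwW : w ∈ W) (hwS : w ∉ Sout) (hadj : G.Adj w η)
    (hB : Disjoint (reachSet G (W \ {w}) η) Sout)
    (hcost : f (reachSet G (W \ {w}) η ∪ {w}) w ≤ 𝒯)
    (hs : s ∈ St) (hsB : s ∈ reachSet G (W \ {w}) η) :
    ∃ Pt' : V → Set V,
      WitnessesOptimality G f 𝒯 W Sout P (insert w (St \ reachSet G (W \ {w}) η)) Pt' := by
  classical
  obtain ⟨⟨⟨hcover, hdisj, hblock⟩, hmin⟩, hsub, hout, hleaf, hnotW, hsink, hnotS⟩ := h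
  obtain ⟨-, hPblock, hPcover⟩ := hpart
  set B := reachSet G (W \ {w}) η
  have hBW : B ⊆ W := fun x hx => (reachSet_subset _ _ _ hx).1
  have hwB : w ∉ B := fun hx => (reachSet_subset _ _ _ hx).2 rfl
  have hself : ∀ u ∈ St, u ∈ Pt u := fun u hu =>
    ((hblock u hu).2.1.symm ▸ rfl : u ∈ St ∩ Pt u).2
  have huniq : ∀ {u v x}, u ∈ St → v ∈ St → x ∈ Pt u → x ∈ Pt v → u = v := by
    intro u v x hu hv hxu hxv
    by_contra hne
    exact disjoint_left.1 (hdisj hu hv hne) hxu hxv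
  obtain ⟨t, ht, hwt⟩ : ∃ t ∈ St, w ∈ Pt t := by
    have : w ∈ ⋃ s ∈ St, Pt s := hcover ▸ mem_univ w
    simpa using this
  have htsub := (hblock t ht).1
  have htW : t ∈ W := by
    by_contra htW
    exact (((hnotW t ht htW).2.symm ▸ ⟨hwt, hwW⟩ : w ∈ (∅ : Set V))).elim
  set C := reachSet G (Pt t \ {w}) t
  have hCP : C ⊆ Pt t := fun x hx => (reachSet_subset _ _ _ hx).1
  have hwC : w ∉ C := fun hx => (reachSet_subset _ _ _ hx).2 rfl
  have htC : t ≠ w → t ∈ C := fun hne => mem_reachSet_self ⟨hself t ht, hne⟩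
  -- connectivity avoiding `w` inside a block cannot enter or leave `B`
  have hBiff : ∀ {A : Set V} {u y}, w ∉ A → u ∈ W → y ∈ W → y ∈ reachSet G A u →
      (u ∈ B ↔ y ∈ B) := by
    intro A u y hwA hu hy hyu
    have := hG.mem_reachSet_diff hW hu hy hyu hwA
    exact ⟨fun hu => reachSet_trans hu this, fun hy => reachSet_trans hy (reachSet_symm this)⟩
  have hCB : ∀ y ∈ C, y ∈ B → t ∈ B := fun y hy hyB =>
    (hBiff (by simp) htW (hBW hyB) hy).2 hyB
  have hBC : t ∈ B → C ⊆ B := fun htB y hy =>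
    (hBiff (by simp) htW
      (hnotS t ht (disjoint_left.1 hB htB) (hCP hy)) hy).1 htB
  have hother : ∀ u ∈ St, u ≠ t → w ∉ Pt u := fun u hu hne hwu => hne (huniq hu ht hwu hwt)
  have hPuB : ∀ u ∈ St, u ≠ t → ∀ y ∈ Pt u, y ∈ B → u ∈ B := by
    intro u hu hne y hy hyB
    have huW : u ∈ W := by
      by_contra huW
      exact (((hnotW u hu huW).2.symm ▸ ⟨hy, hBW hyB⟩ : y ∈ (∅ : Set V))).elim
    exact (hBiff (hother u hu hne) huW (hBW hyB)
      ((hblock u hu).1.mem_reachSet (hself u hu) hy)).2 hyB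
  have hBPu : ∀ u ∈ St, u ≠ t → u ∈ B → Pt u ⊆ B := by
    intro u hu hne huB y hy
    exact (hBiff (hother u hu hne) (hBW huB) (hnotS u hu (disjoint_left.1 hB huB) hy)
      ((hblock u hu).1.mem_reachSet (hself u hu) hy)).1 huB
  have hPC : t ∈ Sout → P t ⊆ C := by
    intro htS y hy
    obtain ⟨hPsub, htP, -⟩ := hPblock t htS
    have hwP : w ∉ P t := fun hwP => by
      have : w ∈ ⋃ s ∈ Sout, P s := mem_biUnion htS hwP
      rw [hPcover] at this
      exact this.2 ⟨hwW, hwS⟩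
    have hPw : P t ⊆ Pt t \ {w} := fun x hx =>
      ⟨(hsink t ⟨htS, htW⟩).1 hx, by rintro rfl; exact hwP hx⟩
    exact reachSet_mono hPw t (hPsub.mem_reachSet htP hy)
  set Q := (Pt t \ C) ∪ B
  have hwQ : w ∈ Q := .inl ⟨hwt, hwC⟩
  have hPtCW : Pt t \ C ⊆ W := by
    intro y hy
    by_cases htS : t ∈ Sout
    · exact (hsink t ⟨htS, htW⟩).2 ⟨hy.1, fun h => hy.2 (hPC htS h)⟩
    · exact hnotS t ht htS hy.1
  have hQW : Q ⊆ W := union_subset hPtCW hBW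
  have hBsub : IsSubtree G (B ∪ {w}) := hW.reachSet_union_singleton hwW η
  have hDsub : IsSubtree G (Pt t \ C) := htsub.diff_reachSet hwt t
  have hQsub : IsSubtree G Q := by
    refine isSubtree_of_forall_reachSet hwQ ?_
    rintro y (hy | hy)
    · exact reachSet_mono subset_union_left _ (hDsub.mem_reachSet hy ⟨hwt, hwC⟩)
    · refine reachSet_mono ?_ _ (hBsub.mem_reachSet (.inl hy) (.inr rfl))
      rintro x (hx | rfl)
      exacts [.inr hx, hwQ]
  have hQcost : f Q w ≤ 𝒯 := by
    rw [hf.max_comp Q w hQsub hwQ]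
    refine iSup₂_le fun x hx => ?_
    have hKsub := hQsub.reachSet_union_singleton hwQ x
    have hKB : ∀ y ∈ reachSet G (Q \ {w}) x, (x ∈ B ↔ y ∈ B) := fun y hy =>
      hBiff (by simp) (hQW hx.1) (hQW (reachSet_subset _ _ _ hy).1) hy
    by_cases hxB : x ∈ B
    · refine (hf.set_mono _ _ _ hKsub hBsub (.inr rfl) ?_).trans hcost
      exact union_subset_union_left _ fun y hy => (hKB y hy).1 hxB
    · refine (hf.set_mono _ _ _ hKsub hDsub (.inr rfl) ?_).trans
        ((hf.diff_reachSet_le htsub (hself t ht) hwt).trans (hblock t ht).2.2)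
      rintro y (hy | rfl)
      · exact (reachSet_subset _ _ _ hy).1.resolve_right fun hyB => hxB ((hKB y hy).2 hyB)
      · exact ⟨hwt, hwC⟩
  set Pt' : V → Set V := fun u => if u = w then Q else if u = t then C else Pt u with hPt'
  have hPw : Pt' w = Q := by simp [hPt']
  have hPtt : t ≠ w → Pt' t = C := fun hne => by simp [hPt', hne]
  have hPu : ∀ {u}, u ≠ w → u ≠ t → Pt' u = Pt u := fun h₁ h₂ => by simp [hPt', h₁, h₂]
  have hsubPt : ∀ {u}, u ≠ w → Pt' u ⊆ Pt u := by
    intro u hu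
    by_cases hut : u = t
    · subst hut; rw [hPtt hu]; exact hCP
    · rw [hPu hu hut]
  have hQdisj : ∀ u ∈ St \ B, u ≠ w → Disjoint Q (Pt' u) := by
    intro u hu huw
    refine disjoint_left.2 ?_
    by_cases hut : u = t
    · subst hut
      rw [hPtt huw]
      rintro y (hy | hy) hyC
      exacts [hy.2 hyC, hu.2 (hCB y hyC hy)]
    · rw [hPu huw hut]
      rintro y (hy | hy) hyu
      exacts [hut (huniq hu.1 ht hyu hy.1), hu.2 (hPuB u hu.1 hut y hyu hy)]
  have hself' : ∀ u ∈ insert w (St \ B), u ∈ Pt' u := by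
    intro u hu
    by_cases huw : u = w
    · subst huw; rw [hPw]; exact hwQ
    · have hu' := (hu.resolve_left huw).1
      by_cases hut : u = t
      · subst hut; rw [hPtt huw]; exact htC huw
      · rw [hPu huw hut]; exact hself u hu'
  have hdisj' : (insert w (St \ B)).Pairwise fun u v => Disjoint (Pt' u) (Pt' v) := by
    intro u hu v hv hne
    by_cases huw : u = w
    · subst huw
      rw [hPw]
      exact hQdisj v (hv.resolve_left hne.symm) hne.symm
    · by_cases hvw : v = w
      · subst hvw
        rw [hPw]
        exact (hQdisj u (hu.resolve_left huw) huw).symm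
      · exact (hdisj (hu.resolve_left huw).1 (hv.resolve_left hvw).1 hne).mono
          (hsubPt huw) (hsubPt hvw)
  have hcard : (insert w (St \ B)).ncard ≤ St.ncard := by
    calc (insert w (St \ B)).ncard ≤ (insert w (St \ {s})).ncard :=
          ncard_le_ncard (insert_subset_insert
            (sdiff_subset_sdiff_right (singleton_subset_iff.2 hsB))) (toFinite _)
      _ ≤ (St \ {s}).ncard + 1 := ncard_insert_le _ _
      _ = St.ncard := ncard_sdiff_singleton_add_one hs (toFinite _)
  refine ⟨Pt', ⟨⟨?_, hdisj', ?_⟩, fun St' P' h' => hcard.trans (hmin St' P' h')⟩,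
    ?_, ?_, hleaf, ?_, ?_, ?_⟩
  · refine eq_univ_of_forall fun y => ?_
    have hQmem : y ∈ Q → y ∈ ⋃ u ∈ insert w (St \ B), Pt' u := fun hy =>
      mem_biUnion (mem_insert w _) (hPw.symm ▸ hy)
    obtain ⟨u, hu, hyu⟩ : ∃ u ∈ St, y ∈ Pt u := by
      have : y ∈ ⋃ s ∈ St, Pt s := hcover ▸ mem_univ y
      simpa using this
    by_cases hut : u = t
    · subst hut
      by_cases hyC : y ∈ C
      · by_cases huB : u ∈ B
        · exact hQmem (.inr (hBC huB hyC))
        · have huw : u ≠ w := by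
            rintro rfl
            exact hyC.choose.2 rfl
          exact mem_biUnion (.inr ⟨hu, huB⟩ : u ∈ insert w (St \ B)) (hPtt huw ▸ hyC)
      · exact hQmem (.inl ⟨hyu, hyC⟩)
    · by_cases huB : u ∈ B
      · exact hQmem (.inr (hBPu u hu hut huB hyu))
      · have huw : u ≠ w := by
          rintro rfl
          exact hother u hu hut (hself u hu)
        exact mem_biUnion (.inr ⟨hu, huB⟩ : u ∈ insert w (St \ B)) (hPu huw hut ▸ hyu)
  · intro u hu
    have hinter : insert w (St \ B) ∩ Pt' u = {u} := by
      refine Subset.antisymm (fun z hz => ?_) (singleton_subset_iff.2 ⟨hu, hself' u hu⟩)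
      by_contra hne
      exact disjoint_left.1 (hdisj' hz.1 hu hne) (hself' z hz.1) hz.2
    refine ⟨?_, hinter, ?_⟩
    all_goals
      by_cases huw : u = w
      · subst huw; rw [hPw]; assumption
      have hu' := (hu.resolve_left huw).1
      by_cases hut : u = t
      swap
      · rw [hPu huw hut]; first | exact (hblock u hu').1 | exact (hblock u hu').2.2
      subst hut
      rw [hPtt huw]
      have hCsub : IsSubtree G C := isSubtree_reachSet ⟨hself u ht, huw⟩
      first
      | exact hCsub
      | exact (hf.set_mono _ _ _ hCsub htsub (htC huw) hCP).trans (hblock u ht).2.2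
  · exact fun u hu => .inr ⟨hsub hu, fun huB => disjoint_left.1 hB huB hu⟩
  · rw [← hout]
    ext u
    constructor
    · rintro ⟨rfl | hu, huW⟩
      exacts [absurd hwW huW, ⟨hu.1, huW⟩]
    · exact fun hu => ⟨.inr ⟨hu.1, fun huB => hu.2 (hBW huB)⟩, hu.2⟩
  · intro u hu huW
    have huw : u ≠ w := by rintro rfl; exact huW hwW
    have hut : u ≠ t := by rintro rfl; exact huW htW
    rw [hPu huw hut]
    exact hnotW u (hu.resolve_left huw).1 huW
  · intro u hu
    have huw : u ≠ w := by rintro rfl; exact hwS hu.1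
    refine ⟨?_, (sdiff_subset_sdiff_left (hsubPt huw)).trans (hsink u hu).2⟩
    by_cases hut : u = t
    · subst hut; rw [hPtt huw]; exact hPC hu.1
    · rw [hPu huw hut]; exact (hsink u hu).1
  · intro u hu huS
    by_cases huw : u = w
    · subst huw; rw [hPw]; exact hQW
    · exact (hsubPt huw).trans (hnotS u (hu.resolve_left huw).1 huS)

/-- if the working tree is RC-viable, then the optimal feasible sink
configuration witnessing the optimality of `(Sout, P)` can be chosen so that it has no
sink inside any outstanding branch of the hub tree. -/
theorem statement_6 [Fintype V] (G : SimpleGraph V) (hG : G.IsTree)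
    (f : Set V → V → ℝ≥0∞) (hf : IsMinmaxMonotone G f) (𝒯 : ℝ≥0∞)
    (W : Set V) (hW : IsSubtree G W)
    (Sout : Set V) (P : V → Set V)
    (hpart : IsPartialConfig G f 𝒯 W Sout P)
    (hopt : OptimalRelative G f 𝒯 W Sout P)
    (r : V) (hS2 : 2 ≤ (Sout ∩ W).ncard) (hW2 : 2 < W.ncard)
    (hroot : GoodRoot G W (Sout ∩ W) r)
    (hRC : RCViable G f 𝒯 W (Sout ∩ W) r) :
    ∃ (St : Set V) (Pt : V → Set V), WitnessesOptimality G f 𝒯 W Sout P St Pt ∧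
      ∀ s ∈ St, ∀ w ∈ hubVerts G W (Sout ∩ W) r, ∀ η ∈ W, G.Adj w η →
        η ∉ hubVerts G W (Sout ∩ W) r → s ∉ reachSet G (W \ {w}) η := by
  classical
  obtain ⟨hrW, hrS, -⟩ := hroot
  set H := hubVerts G W (Sout ∩ W) r
  obtain ⟨St, Pt, h⟩ := hopt
  induction hn : (St \ H).ncard using Nat.strong_induction_on generalizing St Pt with
  | _ n ih =>
    by_cases hgood : ∀ s ∈ St, ∀ w ∈ H, ∀ η ∈ W, G.Adj w η → η ∉ H →
        s ∉ reachSet G (W \ {w}) η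
    · exact ⟨St, Pt, h, hgood⟩
    push Not at hgood
    obtain ⟨s, hs, w, hw, η, hηW, hadj, hη, hsB⟩ := hgood
    have hwW : w ∈ W := hubVerts_subset _ _ _ _ hw
    have hwS : w ∉ Sout := fun hwS =>
      notMem_of_adj_outstanding hG hW h.2.2.2.1 hrS hw hηW hadj hη ⟨hwS, hwW⟩
    have hBH := disjoint_branch_hubVerts hG hW hw hadj hη
    have hBS : Disjoint (reachSet G (W \ {w}) η) Sout := disjoint_left.2 fun x hxB hxS =>
      have hxW : x ∈ W := (reachSet_subset _ _ _ hxB).1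
      disjoint_left.1 hBH hxB (mem_hubVerts_of_mem_sinks hrW hxW ⟨hxS, hxW⟩)
    obtain ⟨Pt', h'⟩ := h.exchange hG hf hW hpart hwW hwS hadj hBS
      (hRC w hw η hηW hadj hη) hs hsB
    refine ih _ ?_ _ Pt' h' rfl
    rw [← hn]
    refine ncard_lt_ncard ⟨?_, fun hsup => ?_⟩ (toFinite _)
    · rintro x ⟨rfl | hx, hxH⟩
      exacts [absurd hw hxH, ⟨hx.1, hxH⟩]
    · have hsH := disjoint_left.1 hBH hsB
      rcases (hsup ⟨hs, hsH⟩).1 with rfl | hs'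
      exacts [hsH hw, hs'.2 hsB]
end

section
/- Let f be a minmax monotone cost function on a finite tree T_in, 𝒯 ≥ 0, and T = (V,E) a rooted working subtree with sink set S and hub tree T_{H(S)}. Let v ∈ V_{H(S)} be such that T(v), the subtree of T rooted at v, is RC-viable. Let u ∈ V_{H(S)} be a child of v in T_{H(S)} such that T(u) = T_{-v}(u) is recursively self-sufficient and there exists a sink s ∈ S ∩ V_{-v}(u) with f(BP(v,s), s) ≤ 𝒯. Then the subtree on BP(v,v) ∪ V_{-v}(u) (rooted at v) is recursively self-sufficient. -/
open SimpleGraph Set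
open scoped ENNReal

variable {V : Type*}

section RootedTree

variable {G : SimpleGraph V} {W : Set V} {r : V}

theorem reachSet_of_walk {A : Set V} {a b : V} (p : G.Walk a b) (hp : ∀ x ∈ p.support, x ∈ A) :
    b ∈ reachSet G A a :=
  ⟨hp a p.start_mem_support, hp b p.end_mem_support, ⟨p.induce A hp⟩⟩

theorem exists_isPath_of_mem_reachSet {A : Set V} {a b : V} (h : b ∈ reachSet G A a) :
    ∃ p : G.Walk a b, p.IsPath ∧ ∀ x ∈ p.support, x ∈ A := by
  classical
  obtain ⟨ha, hb, ⟨q⟩⟩ := h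
  refine ⟨(q.map (Embedding.induce A).toHom).bypass, Walk.bypass_isPath _, fun x hx => ?_⟩
  obtain ⟨z, -, rfl⟩ := List.mem_map.1
    ((Walk.support_map _ q) ▸ Walk.support_bypass_subset_support _ hx)
  exact z.2

theorem onPath_iff_exists_isPath (hG : G.IsTree) (hW : IsSubtree G W) {a b w : V} :
    OnPath G W a b w ↔ a ∈ W ∧ b ∈ W ∧ ∃ p : G.Walk a b, p.IsPath ∧ w ∈ p.support := by
  constructor
  · rintro ⟨ha, hb, -, h⟩
    obtain ⟨p, hp, hpW⟩ := exists_isPath_of_mem_reachSet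
      (⟨ha, hb, hW.preconnected ⟨a, ha⟩ ⟨b, hb⟩⟩ : b ∈ reachSet G W a)
    refine ⟨ha, hb, p, hp, ?_⟩
    by_contra hw
    exact h (reachSet_of_walk p fun x hx => ⟨hpW x hx, fun h => hw (h ▸ hx)⟩)
  · rintro ⟨ha, hb, p, hp, hw⟩
    obtain ⟨q, hq, hqW⟩ := exists_isPath_of_mem_reachSet
      (⟨ha, hb, hW.preconnected ⟨a, ha⟩ ⟨b, hb⟩⟩ : b ∈ reachSet G W a)
    obtain rfl := (hG.existsUnique_path a b).unique hp hq
    refine ⟨ha, hb, hqW w hw, fun h => ?_⟩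
    obtain ⟨q, hq, hqW⟩ := exists_isPath_of_mem_reachSet h
    obtain rfl := (hG.existsUnique_path a b).unique hp hq
    exact (hqW w hw).2 rfl

theorem mem_rootedBelow_iff (hG : G.IsTree) (hW : IsSubtree G W) (hr : r ∈ W) {x y : V} :
    y ∈ rootedBelow G W r x ↔ y ∈ W ∧ ∀ p : G.Walk y r, p.IsPath → x ∈ p.support := by
  refine (onPath_iff_exists_isPath hG hW).trans ⟨?_, ?_⟩
  · rintro ⟨hy, -, p, hp, hx⟩
    exact ⟨hy, fun q hq => (hG.existsUnique_path y r).unique hp hq ▸ hx⟩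
  · rintro ⟨hy, h⟩
    obtain ⟨p, hp, -⟩ := hG.existsUnique_path y r
    exact ⟨hy, hr, p, hp, h p hp⟩

theorem rootedBelow_subset {x : V} : rootedBelow G W r x ⊆ W := fun _ h => h.1

theorem mem_of_mem_rootedBelow {x y : V} (h : y ∈ rootedBelow G W r x) : x ∈ W := h.2.2.1

theorem self_mem_rootedBelow (hr : r ∈ W) {x : V} (hx : x ∈ W) : x ∈ rootedBelow G W r x :=
  ⟨hx, hr, hx, fun ⟨h, _⟩ => h.2 rfl⟩

theorem mem_rootedBelow_root (hr : r ∈ W) {x : V} (hx : x ∈ W) : x ∈ rootedBelow G W r r :=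
  ⟨hx, hr, hr, fun ⟨_, h, _⟩ => h.2 rfl⟩

theorem rootedBelow_trans (hG : G.IsTree) (hW : IsSubtree G W) (hr : r ∈ W) {x y z : V}
    (hyx : y ∈ rootedBelow G W r x) (hzy : z ∈ rootedBelow G W r y) :
    z ∈ rootedBelow G W r x := by
  classical
  rw [mem_rootedBelow_iff hG hW hr] at *
  refine ⟨hzy.1, fun p hp => ?_⟩
  have hy := hzy.2 p hp
  exact Walk.support_dropUntil_subset_support p hy (hyx.2 _ (hp.dropUntil hy))

theorem rootedBelow_antisymm (hG : G.IsTree) (hW : IsSubtree G W) (hr : r ∈ W) {x y : V}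
    (hyx : y ∈ rootedBelow G W r x) (hxy : x ∈ rootedBelow G W r y) : x = y := by
  classical
  rw [mem_rootedBelow_iff hG hW hr] at *
  obtain ⟨p, hp, -⟩ := hG.existsUnique_path y r
  have hx := hyx.2 p hp
  have hq := hp.dropUntil hx
  have hy := hxy.2 _ hq
  have heq := (hG.existsUnique_path y r).unique hp (hq.dropUntil hy)
  have h1 := congrArg Walk.length heq
  have h2 := congrArg Walk.length (p.take_spec hx)
  have h3 := congrArg Walk.length ((p.dropUntil x hx).take_spec hy)
  rw [Walk.length_append] at h2 h3
  exact (Walk.eq_of_length_eq_zero (p := p.takeUntil x hx) (by omega)).symm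

theorem rootedBelow_of_adj (hG : G.IsTree) (hW : IsSubtree G W) (hr : r ∈ W) {x y : V}
    (hx : x ∈ W) (hy : y ∈ W) (h : G.Adj x y) :
    y ∈ rootedBelow G W r x ∨ x ∈ rootedBelow G W r y := by
  obtain ⟨p, hp, -⟩ := hG.existsUnique_path y r
  by_cases hxp : x ∈ p.support
  · exact Or.inl ((onPath_iff_exists_isPath hG hW).2 ⟨hy, hr, p, hp, hxp⟩)
  · exact Or.inr ((onPath_iff_exists_isPath hG hW).2
      ⟨hx, hr, p.cons h, hp.cons hxp, by simp⟩)

theorem exists_parent (hG : G.IsTree) (hW : IsSubtree G W) (hr : r ∈ W) {x : V}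
    (hx : x ∈ W) (hxr : x ≠ r) : ∃ p, G.Adj p x ∧ x ∈ rootedBelow G W r p := by
  obtain ⟨p, hp, -⟩ := hG.existsUnique_path x r
  cases p with
  | nil => exact absurd rfl hxr
  | @cons _ c _ h q =>
    exact ⟨c, h.symm, (onPath_iff_exists_isPath hG hW).2 ⟨hx, hr, q.cons h, hp, by simp⟩⟩

theorem parent_mem_rootedBelow (hG : G.IsTree) (hW : IsSubtree G W) (hr : r ∈ W) {p y z : V}
    (hadj : G.Adj p y) (hpy : y ∈ rootedBelow G W r p) (hzy : y ∈ rootedBelow G W r z)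
    (hne : y ≠ z) : p ∈ rootedBelow G W r z := by
  obtain ⟨q, hq, -⟩ := hG.existsUnique_path p r
  have hpW := mem_of_mem_rootedBelow hpy
  have hyq : y ∉ q.support := fun h => hadj.ne (rootedBelow_antisymm hG hW hr hpy
    ((onPath_iff_exists_isPath hG hW).2 ⟨hpW, hr, q, hq, h⟩))
  have hz := ((mem_rootedBelow_iff hG hW hr).1 hzy).2 (q.cons hadj.symm) (hq.cons hyq)
  rw [Walk.support_cons, List.mem_cons] at hz
  exact (onPath_iff_exists_isPath hG hW).2 ⟨hpW, hr, q, hq, hz.resolve_left hne.symm⟩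

/-- Induction up the rooted tree, from each vertex to its parent. -/
theorem parent_induction [Finite V] (hG : G.IsTree) (hW : IsSubtree G W) (hr : r ∈ W)
    {motive : V → Prop}
    (step : ∀ y, (∀ p, G.Adj p y → y ∈ rootedBelow G W r p → motive p) → motive y) (y : V) :
    motive y := by
  let R : V → V → Prop := fun p y => p ≠ y ∧ y ∈ rootedBelow G W r p
  have : IsTrans V R := ⟨fun a b c hab hbc =>
    ⟨fun h => hbc.1 (by subst h; exact rootedBelow_antisymm hG hW hr hbc.2 hab.2),
      rootedBelow_trans hG hW hr hab.2 hbc.2⟩⟩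
  have : Std.Irrefl R := ⟨fun a h => h.1 rfl⟩
  exact (Finite.wellFounded_of_trans_of_irrefl R).induction y
    fun y ih => step y fun p hp hy => ih p ⟨hp.ne, hy⟩

theorem rootedBelow_total [Finite V] (hG : G.IsTree) (hW : IsSubtree G W) (hr : r ∈ W)
    {x x' y : V} (hx : y ∈ rootedBelow G W r x) (hx' : y ∈ rootedBelow G W r x') :
    x ∈ rootedBelow G W r x' ∨ x' ∈ rootedBelow G W r x := by
  induction y using parent_induction hG hW hr with | step y ih
  by_cases h : y = x
  · exact Or.inl (h ▸ hx')
  by_cases h' : y = x'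
  · exact Or.inr (h' ▸ hx)
  have hyr : y ≠ r := by
    rintro rfl
    exact h (rootedBelow_antisymm hG hW hr
      (mem_rootedBelow_root hr (mem_of_mem_rootedBelow hx)) hx)
  obtain ⟨p, hp, hyp⟩ := exists_parent hG hW hr hx.1 hyr
  exact ih p hp hyp (parent_mem_rootedBelow hG hW hr hp hyp hx h)
    (parent_mem_rootedBelow hG hW hr hp hyp hx' h')

theorem exists_parent_of_mem_rootedBelow (hG : G.IsTree) (hW : IsSubtree G W) (hr : r ∈ W)
    {x y : V} (h : y ∈ rootedBelow G W r x) (hne : y ≠ x) :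
    ∃ p, G.Adj p y ∧ y ∈ rootedBelow G W r p ∧ p ∈ rootedBelow G W r x := by
  obtain ⟨p, hp, hyp⟩ := exists_parent hG hW hr h.1 (by
    rintro rfl
    exact hne (rootedBelow_antisymm hG hW hr
      (mem_rootedBelow_root hr (mem_of_mem_rootedBelow h)) h))
  exact ⟨p, hp, hyp, parent_mem_rootedBelow hG hW hr hp hyp h hne⟩

theorem exists_child_of_mem_rootedBelow [Finite V] (hG : G.IsTree) (hW : IsSubtree G W)
    (hr : r ∈ W) {x y : V} (h : y ∈ rootedBelow G W r x) (hne : y ≠ x) :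
    ∃ c, G.Adj x c ∧ c ∈ rootedBelow G W r x ∧ y ∈ rootedBelow G W r c := by
  induction y using parent_induction hG hW hr with | step y ih
  obtain ⟨p, hp, hyp, hpx⟩ := exists_parent_of_mem_rootedBelow hG hW hr h hne
  by_cases hpe : p = x
  · subst hpe
    exact ⟨y, hp, hyp, self_mem_rootedBelow hr h.1⟩
  · obtain ⟨c, hc, hcx, hpc⟩ := ih p hp hyp hpx hpe
    exact ⟨c, hc, hcx, rootedBelow_trans hG hW hr hpc hyp⟩

theorem reachSet_adj {A : Set V} {a y z : V} (hy : y ∈ reachSet G A a) (hz : z ∈ A)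
    (h : G.Adj y z) : z ∈ reachSet G A a := by
  obtain ⟨ha, hyA, hreach⟩ := hy
  exact ⟨ha, hz, hreach.trans (Adj.reachable (G := G.induce A) (u := ⟨y, hyA⟩) (v := ⟨z, hz⟩) h)⟩

theorem mem_of_mem_reachSet_of_adj_closed {A C : Set V} {a b : V} (hab : b ∈ reachSet G A a)
    (ha : a ∈ C) (hC : ∀ y ∈ C, ∀ z ∈ A, G.Adj y z → z ∈ C) : b ∈ C := by
  obtain ⟨haA, hbA, ⟨p⟩⟩ := hab
  suffices H : ∀ (x y : A), (G.induce A).Walk x y → x.1 ∈ C → y.1 ∈ C from H _ _ p ha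
  intro x y p
  induction p with
  | nil => exact id
  | @cons x z y h _ ih => exact fun hx => ih (hC _ hx _ z.2 h)

/-- A set closed under taking parents, up to its top vertex `v`, is connected to `v`. -/
theorem subset_reachSet_of_parent_closed [Finite V] (hG : G.IsTree) (hW : IsSubtree G W)
    (hr : r ∈ W) {U A : Set V} {v : V} (hUA : U ⊆ A) (hv : v ∈ U)
    (hU : ∀ y ∈ U, y ≠ v → ∃ p ∈ U, G.Adj p y ∧ y ∈ rootedBelow G W r p) :
    U ⊆ reachSet G A v := by
  intro y hy
  induction y using parent_induction hG hW hr with | step y ih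
  by_cases hyv : y = v
  · subst hyv
    exact ⟨hUA hy, hUA hy, Reachable.refl _⟩
  · obtain ⟨p, hp, hadj, hyp⟩ := hU y hy hyv
    exact reachSet_adj (ih p hadj hyp hp) (hUA hy) hadj

theorem isSubtree_of_parent_closed [Finite V] (hG : G.IsTree) (hW : IsSubtree G W)
    (hr : r ∈ W) {U : Set V} {v : V} (hv : v ∈ U)
    (hU : ∀ y ∈ U, y ≠ v → ∃ p ∈ U, G.Adj p y ∧ y ∈ rootedBelow G W r p) :
    IsSubtree G U := by
  have h := subset_reachSet_of_parent_closed hG hW hr Subset.rfl hv hU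
  have : Nonempty U := ⟨⟨v, hv⟩⟩
  refine (connected_iff _).2 ⟨fun x y => ?_, this⟩
  obtain ⟨_, _, hx⟩ := h x.2
  obtain ⟨_, _, hy⟩ := h y.2
  exact hx.symm.trans hy

theorem reachSet_sdiff_parent [Finite V] (hG : G.IsTree) (hW : IsSubtree G W) (hr : r ∈ W)
    {w c : V} (hadj : G.Adj w c) (hc : c ∈ rootedBelow G W r w) :
    reachSet G (W \ {w}) c = rootedBelow G W r c := by
  apply Subset.antisymm
  · intro y hy
    refine mem_of_mem_reachSet_of_adj_closed hy (self_mem_rootedBelow hr hc.1) ?_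
    rintro y hy z ⟨hz, hzw⟩ h
    rcases rootedBelow_of_adj hG hW hr hy.1 hz h with h1 | h1
    · exact rootedBelow_trans hG hW hr hy h1
    · by_cases hyc : y = c
      · subst hyc
        exact absurd (rootedBelow_antisymm hG hW hr
          (parent_mem_rootedBelow hG hW hr hadj hc h1 h.ne)
          (parent_mem_rootedBelow hG hW hr h.symm h1 hc hadj.ne')) hzw
      · exact parent_mem_rootedBelow hG hW hr h.symm h1 hy hyc
  · refine subset_reachSet_of_parent_closed hG hW hr ?_ (self_mem_rootedBelow hr hc.1) ?_
    · refine fun y hy => ⟨hy.1, fun hyw => hadj.ne ?_⟩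
      obtain rfl : y = w := hyw
      exact rootedBelow_antisymm hG hW hr hc hy
    · intro y hy hne
      obtain ⟨p, hp, hyp, hpc⟩ := exists_parent_of_mem_rootedBelow hG hW hr hy hne
      exact ⟨p, hpc, hp, hyp⟩

theorem mem_pathSet_iff [Finite V] (hG : G.IsTree) (hW : IsSubtree G W) (hr : r ∈ W)
    {v t w : V} (ht : t ∈ rootedBelow G W r v) :
    w ∈ pathSet G W v t ↔ w ∈ rootedBelow G W r v ∧ t ∈ rootedBelow G W r w := by
  have hvW := mem_of_mem_rootedBelow ht
  constructor
  · rintro ⟨-, -, hwW, h⟩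
    by_contra hcon
    have hvw : v ≠ w := by
      rintro rfl
      exact hcon ⟨self_mem_rootedBelow hr hvW, ht⟩
    let U : Set V := {y | y ∈ rootedBelow G W r v ∧
      ¬(w ∈ rootedBelow G W r v ∧ y ∈ rootedBelow G W r w)}
    refine h (subset_reachSet_of_parent_closed hG hW hr (U := U) ?_ ?_ ?_ ⟨ht, hcon⟩)
    · refine fun y hy => ⟨hy.1.1, fun hyw => ?_⟩
      obtain rfl : y = w := hyw
      exact hy.2 ⟨hy.1, self_mem_rootedBelow hr hwW⟩
    · exact ⟨self_mem_rootedBelow hr hvW,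
        fun h => hvw (rootedBelow_antisymm hG hW hr h.1 h.2)⟩
    · intro y hy hne
      obtain ⟨p, hp, hyp, hpv⟩ := exists_parent_of_mem_rootedBelow hG hW hr hy.1 hne
      exact ⟨p, ⟨hpv, fun h => hy.2 ⟨h.1, rootedBelow_trans hG hW hr h.2 hyp⟩⟩, hp, hyp⟩
  · rintro ⟨hwv, htw⟩
    refine ⟨hvW, ht.1, hwv.1, fun h => ?_⟩
    have hvw : v ≠ w := h.1.2
    refine hvw (rootedBelow_antisymm hG hW hr hwv ?_)
    by_contra hv
    refine (mem_of_mem_reachSet_of_adj_closed (C := W \ rootedBelow G W r w) h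
      ⟨hvW, hv⟩ ?_).2 htw
    rintro y ⟨hyW, hy⟩ z ⟨hz, hzw⟩ hyz
    refine ⟨hz, fun hzw' => hy ?_⟩
    rcases rootedBelow_of_adj hG hW hr hyW hz hyz with h1 | h1
    · exact parent_mem_rootedBelow hG hW hr hyz h1 hzw' hzw
    · exact rootedBelow_trans hG hW hr hzw' h1

theorem hubVerts_of_mem_rootedBelow (hG : G.IsTree) (hW : IsSubtree G W) (hr : r ∈ W)
    {S : Set V} {x y : V} (hy : y ∈ hubVerts G W S r) (h : y ∈ rootedBelow G W r x) :
    x ∈ hubVerts G W S r := by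
  obtain ⟨s, hs, hsy⟩ := hy
  exact ⟨s, hs, rootedBelow_trans hG hW hr h hsy⟩

theorem mem_bulkPath_iff [Finite V] (hG : G.IsTree) (hW : IsSubtree G W) (hr : r ∈ W)
    {S : Set V} {v t y : V} (ht : t ∈ rootedBelow G W r v) (hub : t ∈ hubVerts G W S r) :
    y ∈ bulkPath G W S r v t ↔ ∃ w ∈ rootedBelow G W r v, t ∈ rootedBelow G W r w ∧
      (y = w ∨ ∃ c ∈ rootedBelow G W r w, G.Adj w c ∧ c ∉ hubVerts G W S r ∧
        y ∈ rootedBelow G W r c) := by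
  have key : ∀ w, t ∈ rootedBelow G W r w → ∀ c ∈ W, G.Adj w c → c ∉ hubVerts G W S r →
      c ∈ rootedBelow G W r w := fun w hw c hc hadj hch =>
    (rootedBelow_of_adj hG hW hr (mem_of_mem_rootedBelow hw) hc hadj).resolve_right fun h =>
      hch (hubVerts_of_mem_rootedBelow hG hW hr hub (rootedBelow_trans hG hW hr h hw))
  simp only [bulkPath, branchesAt, mem_union, mem_iUnion, mem_ofPred_eq, exists_prop,
    mem_pathSet_iff hG hW hr ht]
  constructor
  · rintro (⟨h1, h2⟩ | ⟨w, ⟨h1, h2⟩, c, ⟨hc, hadj, hch⟩, hy⟩)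
    · exact ⟨y, h1, h2, Or.inl rfl⟩
    · have hcw := key w h2 c hc hadj hch
      rw [reachSet_sdiff_parent hG hW hr hadj hcw] at hy
      exact ⟨w, h1, h2, Or.inr ⟨c, hcw, hadj, hch, hy⟩⟩
  · rintro ⟨w, h1, h2, rfl | ⟨c, hcw, hadj, hch, hy⟩⟩
    · exact Or.inl ⟨h1, h2⟩
    · rw [← reachSet_sdiff_parent hG hW hr hadj hcw] at hy
      exact Or.inr ⟨w, ⟨h1, h2⟩, c, ⟨hcw.1, hadj, hch⟩, hy⟩

theorem isSubtree_bulkPath [Finite V] (hG : G.IsTree) (hW : IsSubtree G W) (hr : r ∈ W)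
    {S : Set V} {v t : V} (ht : t ∈ rootedBelow G W r v) (hub : t ∈ hubVerts G W S r) :
    IsSubtree G (bulkPath G W S r v t) := by
  refine isSubtree_of_parent_closed hG hW hr (v := v) ((mem_bulkPath_iff hG hW hr ht hub).2
    ⟨v, self_mem_rootedBelow hr (mem_of_mem_rootedBelow ht), ht, Or.inl rfl⟩) fun y hy hne => ?_
  obtain ⟨w, h1, h2, rfl | ⟨c, hcw, hadj, hch, hyc⟩⟩ := (mem_bulkPath_iff hG hW hr ht hub).1 hy
  · obtain ⟨p, hp, hyp, hpv⟩ := exists_parent_of_mem_rootedBelow hG hW hr h1 hne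
    exact ⟨p, (mem_bulkPath_iff hG hW hr ht hub).2
      ⟨p, hpv, rootedBelow_trans hG hW hr hyp h2, Or.inl rfl⟩, hp, hyp⟩
  · by_cases hyc' : y = c
    · subst hyc'
      exact ⟨w, (mem_bulkPath_iff hG hW hr ht hub).2 ⟨w, h1, h2, Or.inl rfl⟩, hadj, hcw⟩
    · obtain ⟨p, hp, hyp, hpc⟩ := exists_parent_of_mem_rootedBelow hG hW hr hyc hyc'
      exact ⟨p, (mem_bulkPath_iff hG hW hr ht hub).2
        ⟨w, h1, h2, Or.inr ⟨c, hcw, hadj, hch, hpc⟩⟩, hp, hyp⟩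

theorem eq_of_mem_rootedBelow_of_isLeafOf [Finite V] (hG : G.IsTree) (hW : IsSubtree G W)
    (hr : r ∈ W) {t y : V} (ht : IsLeafOf G W t) (htr : t ≠ r) (h : y ∈ rootedBelow G W r t) :
    y = t := by
  by_contra hne
  obtain ⟨c, hc, hct, -⟩ := exists_child_of_mem_rootedBelow hG hW hr h hne
  obtain ⟨p, hp, htp⟩ := exists_parent hG hW hr ht.1 htr
  obtain rfl := ht.2.unique ⟨hct.1, hc⟩ ⟨mem_of_mem_rootedBelow htp, hp.symm⟩
  exact hp.ne (rootedBelow_antisymm hG hW hr htp hct)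

/-- `x` is a hub vertex below `u` that is topmost among the vertices not lying above `s`. -/
def IsTopOff (G : SimpleGraph V) (W S : Set V) (r u s x : V) : Prop :=
  x ∈ hubVerts G W S r ∧ x ∈ rootedBelow G W r u ∧ s ∉ rootedBelow G W r x ∧
    ∀ z, x ∈ rootedBelow G W r z → z ≠ x → s ∈ rootedBelow G W r z

theorem IsTopOff.eq [Finite V] (hG : G.IsTree) (hW : IsSubtree G W) (hr : r ∈ W)
    {S : Set V} {u s x x' y : V} (hx : IsTopOff G W S r u s x) (hx' : IsTopOff G W S r u s x')
    (hy : y ∈ rootedBelow G W r x) (hy' : y ∈ rootedBelow G W r x') : x = x' := by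
  by_contra hne
  rcases rootedBelow_total hG hW hr hy hy' with h | h
  · exact hx'.2.2.1 (hx.2.2.2 x' h (Ne.symm hne))
  · exact hx.2.2.1 (hx'.2.2.2 x h hne)

theorem IsTopOff.notMem_bulkPath [Finite V] (hG : G.IsTree) (hW : IsSubtree G W) (hr : r ∈ W)
    {S : Set V} {u v s x y : V} (hx : IsTopOff G W S r u s x) (hsv : s ∈ rootedBelow G W r v)
    (hub : s ∈ hubVerts G W S r) (hy : y ∈ rootedBelow G W r x) :
    y ∉ bulkPath G W S r v s := by
  intro h
  obtain ⟨w, -, h2, rfl | ⟨c, hcw, hadj, hch, hyc⟩⟩ := (mem_bulkPath_iff hG hW hr hsv hub).1 h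
  · exact hx.2.2.1 (rootedBelow_trans hG hW hr hy h2)
  · rcases rootedBelow_total hG hW hr hy hyc with h | h
    · exact hch (hubVerts_of_mem_rootedBelow hG hW hr hx.1 h)
    · have hne : c ≠ x := fun h => hch (h ▸ hx.1)
      exact hx.2.2.1 (rootedBelow_trans hG hW hr
        (parent_mem_rootedBelow hG hW hr hadj hcw h hne) h2)

theorem exists_isTopOff [Finite V] (hG : G.IsTree) (hW : IsSubtree G W) (hr : r ∈ W)
    {S : Set V} {u v s y : V} (huv : u ∈ rootedBelow G W r v) (hsu : s ∈ rootedBelow G W r u)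
    (hub : s ∈ hubVerts G W S r) (hyu : y ∈ rootedBelow G W r u)
    (hy : y ∉ bulkPath G W S r v s) :
    ∃ x, IsTopOff G W S r u s x ∧ y ∈ rootedBelow G W r x := by
  have hsv := rootedBelow_trans hG hW hr huv hsu
  have hoff : ∀ z, y ∈ rootedBelow G W r z → z ∈ rootedBelow G W r u →
      s ∉ rootedBelow G W r z → ∃ x, IsTopOff G W S r u s x ∧ y ∈ rootedBelow G W r x := by
    intro z hyz hzu hsz
    induction z using parent_induction hG hW hr with | step z ih
    obtain ⟨p, hp, hzp, hpu⟩ := exists_parent_of_mem_rootedBelow hG hW hr hzu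
      (fun h => hsz (h ▸ hsu))
    by_cases hsp : s ∈ rootedBelow G W r p
    · refine ⟨z, ⟨?_, hzu, hsz, fun a ha hne => rootedBelow_trans hG hW hr
        (parent_mem_rootedBelow hG hW hr hp hzp ha hne.symm) hsp⟩, hyz⟩
      by_contra hz
      exact hy ((mem_bulkPath_iff hG hW hr hsv hub).2
        ⟨p, rootedBelow_trans hG hW hr huv hpu, hsp, Or.inr ⟨z, hzp, hp, hz, hyz⟩⟩)
    · exact ih p hp hzp (rootedBelow_trans hG hW hr hzp hyz) hpu hsp
  refine hoff y (self_mem_rootedBelow hr hyu.1) hyu fun h => hy ?_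
  exact (mem_bulkPath_iff hG hW hr hsv hub).2
    ⟨y, rootedBelow_trans hG hW hr huv hyu, h, Or.inl rfl⟩

end RootedTree

/-- Lemma `RecursiveSS` (1): if `T(v)` is RC-viable, `u` is a hub-tree child
of `v` with `T(u) = T₋ᵥ(u)` recursively self-sufficient, and some sink `s ∈ S ∩ V₋ᵥ(u)`
satisfies `f(BP(v,s), s) ≤ 𝒯` (i.e. `v` can evacuate to `s`), then
`BP(v,v) ∪ V₋ᵥ(u)` is recursively self-sufficient. -/
theorem statement_7 [Fintype V] (G : SimpleGraph V) (hG : G.IsTree)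
    (f : Set V → V → ℝ≥0∞) (hf : IsMinmaxMonotone G f) (𝒯 : ℝ≥0∞)
    (W S : Set V) (hW : IsSubtree G W) (hSW : S ⊆ W)
    (hSleaf : ∀ s ∈ S, IsLeafOf G W s)
    (r : V) (hS2 : 2 ≤ S.ncard) (hW2 : 2 < W.ncard) (hroot : GoodRoot G W S r)
    (v : V) (hv : v ∈ hubVerts G W S r)
    (hRCv : RCViableBelow G f 𝒯 W S r v)
    (u : V) (hchild : HubParent G W S r u v)
    (hrec : RecursivelySelfSufficientOn G f 𝒯 W S r (rootedBelow G W r u))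
    (s : V) (hs : s ∈ S ∩ reachSet G (W \ {v}) u)
    (hbp : f (bulkPath G W S r v s) s ≤ 𝒯) :
    RecursivelySelfSufficientOn G f 𝒯 W S r
      (bulkPath G W S r v v ∪ reachSet G (W \ {v}) u) := by
  classical
  have hr := hroot.1
  obtain ⟨hsS, hsu⟩ := hs
  obtain ⟨-, -, hadj, huv⟩ := hchild
  rw [reachSet_sdiff_parent hG hW hr hadj.symm huv] at hsu ⊢
  have hsv := rootedBelow_trans hG hW hr huv hsu
  have hvW := mem_of_mem_rootedBelow hsv
  have hvv := self_mem_rootedBelow (G := G) hr hvW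
  have hubS : ∀ t ∈ S, t ∈ hubVerts G W S r := fun t ht =>
    ⟨t, ht, self_mem_rootedBelow hr (hSW ht)⟩
  have hub := hubS s hsS
  set B := bulkPath G W S r v s
  have hBv : bulkPath G W S r v v ⊆ B := fun y hy => by
    obtain ⟨w, h1, h2, h3⟩ := (mem_bulkPath_iff hG hW hr hvv hv).1 hy
    exact (mem_bulkPath_iff hG hW hr hsv hub).2 ⟨w, h1, rootedBelow_trans hG hW hr h2 hsv, h3⟩
  have hBA : B ⊆ bulkPath G W S r v v ∪ rootedBelow G W r u := by
    intro y hy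
    obtain ⟨w, h1, h2, h3⟩ := (mem_bulkPath_iff hG hW hr hsv hub).1 hy
    by_cases hwv : w = v
    · subst hwv
      exact Or.inl ((mem_bulkPath_iff hG hW hr hvv hv).2 ⟨w, h1, hvv, h3⟩)
    · have hwu : w ∈ rootedBelow G W r u := by
        rcases rootedBelow_total hG hW hr h2 hsu with h | h
        · exact h
        · by_cases hwu : u = w
          · exact hwu ▸ h
          · exact absurd (rootedBelow_antisymm hG hW hr
              (parent_mem_rootedBelow hG hW hr hadj.symm huv h hwu) h1) hwv
      refine Or.inr ?_
      rcases h3 with rfl | ⟨c, hcw, -, -, hyc⟩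
      · exact hwu
      · exact rootedBelow_trans hG hW hr (rootedBelow_trans hG hW hr hwu hcw) hyc
  have hAv : bulkPath G W S r v v ∪ rootedBelow G W r u ⊆ rootedBelow G W r v := by
    rintro y (hy | hy)
    · obtain ⟨w, h1, -, rfl | ⟨c, hcw, -, -, hyc⟩⟩ := (mem_bulkPath_iff hG hW hr hvv hv).1 hy
      · exact h1
      · exact rootedBelow_trans hG hW hr (rootedBelow_trans hG hW hr h1 hcw) hyc
    · exact rootedBelow_trans hG hW hr huv hy
  have hcap : ∀ x ∈ rootedBelow G W r u,
      rootedBelow G W r x ∩ rootedBelow G W r u = rootedBelow G W r x := fun x hx =>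
    inter_eq_left.2 fun y hy => rootedBelow_trans hG hW hr hx hy
  have hSS : ∀ x, x ∈ hubVerts G W S r ∩ rootedBelow G W r u →
      SelfSufficient G f 𝒯 S (rootedBelow G W r x) := fun x hx => hcap x hx.2 ▸ hrec x hx
  rintro w ⟨hwhub, hwA⟩
  by_cases hwu : w ∈ rootedBelow G W r u
  · rw [inter_eq_left.2 ((show rootedBelow G W r w ⊆ rootedBelow G W r u from
      fun y hy => rootedBelow_trans hG hW hr hwu hy).trans subset_union_right)]
    exact hSS w ⟨hwhub, hwu⟩
  obtain rfl : w = v := by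
    obtain ⟨x, h1, h2, rfl | ⟨c, -, -, hch, hwc⟩⟩ :=
      (mem_bulkPath_iff hG hW hr hvv hv).1 (hwA.resolve_right hwu)
    · exact rootedBelow_antisymm hG hW hr h2 h1
    · exact absurd (hubVerts_of_mem_rootedBelow hG hW hr hwhub hwc) hch
  rw [inter_eq_right.2 hAv]
  have hsink : ∀ t ∈ S ∩ (bulkPath G W S r w w ∪ rootedBelow G W r u), t ≠ s →
      t ∈ rootedBelow G W r u ∧ t ∉ B := by
    rintro t ⟨htS, htA⟩ hts
    have htB : t ∉ B := fun h => by
      obtain ⟨x, -, h2, rfl | ⟨c, -, -, hch, htc⟩⟩ := (mem_bulkPath_iff hG hW hr hsv hub).1 h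
      · exact hts (eq_of_mem_rootedBelow_of_isLeafOf hG hW hr (hSleaf t htS)
          (fun h => hroot.2.1 (h ▸ htS)) h2).symm
      · exact hch (hubVerts_of_mem_rootedBelow hG hW hr (hubS t htS) htc)
    exact ⟨htA.resolve_left fun h => htB (hBv h), htB⟩
  have htop : ∀ y, ∃ x, y ∈ rootedBelow G W r u → y ∉ B →
      IsTopOff G W S r u s x ∧ y ∈ rootedBelow G W r x := by
    intro y
    by_cases h : y ∈ rootedBelow G W r u ∧ y ∉ B
    · obtain ⟨x, hx⟩ := exists_isTopOff hG hW hr huv hsu hub h.1 h.2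
      exact ⟨x, fun _ _ => hx⟩
    · exact ⟨y, fun h1 h2 => absurd ⟨h1, h2⟩ h⟩
  choose top htop using htop
  choose! Q hQcover hQblock hQdisj using hSS
  have hQsub : ∀ t ∈ S ∩ (bulkPath G W S r w w ∪ rootedBelow G W r u), t ≠ s →
      IsTopOff G W S r u s (top t) ∧ t ∈ S ∩ rootedBelow G W r (top t) ∧
        Q (top t) t ⊆ rootedBelow G W r (top t) := by
    intro t ht hts
    obtain ⟨h1, h2⟩ := hsink t ht hts
    obtain ⟨h3, h4⟩ := htop t h1 h2
    refine ⟨h3, ⟨ht.1, h4⟩, ?_⟩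
    rw [← hQcover (top t) ⟨h3.1, h3.2.1⟩]
    exact fun y hy => mem_biUnion (show t ∈ S ∩ rootedBelow G W r (top t) from ⟨ht.1, h4⟩) hy
  have hdisjB : ∀ t ∈ S ∩ (bulkPath G W S r w w ∪ rootedBelow G W r u), t ≠ s →
      Disjoint B (Q (top t) t) := by
    intro t ht hts
    obtain ⟨h1, -, h3⟩ := hQsub t ht hts
    exact Set.disjoint_left.2 fun y hyB hyQ => h1.notMem_bulkPath hG hW hr hsv hub (h3 hyQ) hyB
  refine ⟨fun t => if t = s then B else Q (top t) t, ?_, ?_, ?_⟩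
  · apply Subset.antisymm
    · refine iUnion₂_subset fun t ht => ?_
      by_cases hts : t = s
      · simpa [hts] using hBA
      · obtain ⟨h1, -, h3⟩ := hQsub t ht hts
        simp only [hts, if_false]
        exact fun y hy => Or.inr (rootedBelow_trans hG hW hr h1.2.1 (h3 hy))
    · intro y hy
      by_cases hyB : y ∈ B
      · exact mem_biUnion (show s ∈ S ∩ _ from ⟨hsS, Or.inr hsu⟩) (by simpa using hyB)
      · have hyu := hy.resolve_left fun h => hyB (hBv h)
        obtain ⟨hx, hyx⟩ := htop y hyu hyB
        have hyx' := hyx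
        rw [← hQcover (top y) ⟨hx.1, hx.2.1⟩] at hyx'
        obtain ⟨t, ht, hyt⟩ := mem_iUnion₂.1 hyx'
        have hts : t ≠ s := fun h => hx.2.2.1 (h ▸ ht.2)
        have htA : t ∈ S ∩ (bulkPath G W S r w w ∪ rootedBelow G W r u) :=
          ⟨ht.1, Or.inr (rootedBelow_trans hG hW hr hx.2.1 ht.2)⟩
        obtain ⟨h1, h2, -⟩ := hQsub t htA hts
        refine mem_biUnion htA ?_
        simp only [hts, if_false]
        rwa [h1.eq hG hW hr hx h2.2 ht.2]
  · intro t ht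
    by_cases hts : t = s
    · subst hts
      simp only [if_true]
      exact ⟨isSubtree_bulkPath hG hW hr hsv hub, (mem_bulkPath_iff hG hW hr hsv hub).2
        ⟨t, hsv, self_mem_rootedBelow hr hsv.1, Or.inl rfl⟩, hbp⟩
    · simp only [hts, if_false]
      obtain ⟨h1, h2, -⟩ := hQsub t ht hts
      exact hQblock (top t) ⟨h1.1, h1.2.1⟩ t h2
  · intro t ht t' ht' hne
    by_cases hts : t = s
    · have hts' : t' ≠ s := fun h => hne (hts.trans h.symm)
      simpa only [hts, hts', if_true, if_false] using hdisjB t' ht' hts'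
    by_cases hts' : t' = s
    · simpa only [hts, hts', if_true, if_false] using (hdisjB t ht hts).symm
    simp only [hts, hts', if_false]
    obtain ⟨h1, h2, h3⟩ := hQsub t ht hts
    obtain ⟨h1', h2', h3'⟩ := hQsub t' ht' hts'
    by_cases heq : top t = top t'
    · rw [← heq] at h2' ⊢
      exact hQdisj (top t) ⟨h1.1, h1.2.1⟩ h2 h2' hne
    · exact Set.disjoint_left.2 fun y hy hy' => heq (h1.eq hG hW hr h1' (h3 hy) (h3' hy'))
end
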